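/- There is no e ∈ (0,1) at which the two functions α̂(e) := (2(1−e²)² + 4)J₁(e) − e(6−e²)J₁'(e) and β̂(e) := −3(1−e²)J₁(e) + e((2−e²)(1−e²) + 1)J₁'(e) vanish simultaneously; that is, the zeros of ∂A₁/∂G and ∂B₁/∂G on 0 < e < 1 are distinct. -/

import Mathlib

open Real Set

/-- Bessel function of integer order `n`. -/
noncomputable def besselJ (n : ℤ) (x : ℝ) : ℝ :=
  (1 / (2 * π)) * ∫ t in (0:ℝ)..(2 * π), Real.cos (n * t - x * Real.sin t)

/-- Derivative of the Bessel function with respect to its argument. -/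
noncomputable def besselJd (n : ℤ) (x : ℝ) : ℝ := deriv (besselJ n) x

/-- The Fourier coefficient `A_m(e)`. -/
noncomputable def coefA (m : ℕ) (e : ℝ) : ℝ :=
  (4 / ((m:ℝ) ^ 2 * e ^ 2)) *
    (2 * m * e * (1 - e ^ 2) * besselJd m (m * e) - (2 - e ^ 2) * besselJ m (m * e))

/-- The Fourier coefficient `B_m(e)`. -/
noncomputable def coefB (m : ℕ) (e : ℝ) : ℝ :=
  -(8 / ((m:ℝ) ^ 2 * e ^ 2)) * Real.sqrt (1 - e ^ 2) *
    (e * besselJd m (m * e) - m * (1 - e ^ 2) * besselJ m (m * e))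

noncomputable def alphaHat (e : ℝ) : ℝ :=
  (2 * (1 - e ^ 2) ^ 2 + 4) * besselJ 1 e - e * (6 - e ^ 2) * besselJd 1 e

noncomputable def betaHat (e : ℝ) : ℝ :=
  -3 * (1 - e ^ 2) * besselJ 1 e + e * ((2 - e ^ 2) * (1 - e ^ 2) + 1) * besselJd 1 e

lemma aux_deriv (e : ℝ) : besselJd 1 e =
    (1 / (2 * π)) * ∫ t in (0:ℝ)..(2 * π), Real.sin (t - e * Real.sin t) * Real.sin t := by
  unfold besselJd
  have h := (intervalIntegral.hasDerivAt_integral_of_dominated_loc_of_deriv_le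
    (μ := MeasureTheory.volume) (a := 0) (b := 2 * π) (x₀ := e) (s := Set.univ)
    (F := fun x t => Real.cos (((1:ℤ):ℝ) * t - x * Real.sin t))
    (F' := fun x t => Real.sin (t - x * Real.sin t) * Real.sin t)
    (bound := fun _ => 1) Filter.univ_mem
    (Filter.Eventually.of_forall fun x =>
      (Continuous.aestronglyMeasurable (by fun_prop)))
    (Continuous.intervalIntegrable (by fun_prop) _ _)
    (Continuous.aestronglyMeasurable (by fun_prop))
    (Filter.Eventually.of_forall fun t _ x _ => by
      rw [norm_mul]
      exact mul_le_one₀ (Real.abs_sin_le_one _) (norm_nonneg _) (Real.abs_sin_le_one _))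
    (Continuous.intervalIntegrable (by fun_prop) _ _)
    (Filter.Eventually.of_forall fun t _ x _ => by
      have h1 : HasDerivAt (fun x : ℝ => ((1:ℤ):ℝ) * t - x * Real.sin t) (-(1 * Real.sin t)) x :=
        ((hasDerivAt_id x).mul_const (Real.sin t)).const_sub _
      refine h1.cos.congr_deriv ?_
      push_cast
      simp)).2
  exact (h.const_mul (1 / (2 * π))).deriv

lemma aux_I2 : ∫ t in (0:ℝ)..(2 * π), Real.sin t ^ 2 = π := by
  rw [integral_sin_sq]; simp

lemma aux_I4 : ∫ t in (0:ℝ)..(2 * π), Real.sin t ^ 4 = 3 * π / 4 := by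
  have := integral_sin_pow (a := 0) (b := 2 * π) 2
  norm_num at this
  rw [this]
  ring

lemma aux_lower (e : ℝ) (he : 0 < e) : (1 / 2) * (1 - 3 * e ^ 2 / 8) ≤ besselJd 1 e := by
  rw [aux_deriv]
  have h0 : ∫ t in (0:ℝ)..(2 * π), Real.sin t * Real.sin (e * Real.sin t) * Real.cos t = 0 := by
    have := intervalIntegral.integral_eq_sub_of_hasDerivAt (a := 0) (b := 2 * π)
      (f := fun t => - Real.sin t * Real.cos (e * Real.sin t) / e
        + Real.sin (e * Real.sin t) / e ^ 2)
      (f' := fun t => Real.sin t * Real.sin (e * Real.sin t) * Real.cos t)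
      (fun t _ => by
        have h1 : HasDerivAt (fun t => e * Real.sin t) (e * Real.cos t) t :=
          (Real.hasDerivAt_sin t).const_mul e
        have h2 := (((Real.hasDerivAt_sin t).neg.mul h1.cos).div_const e).add
          (h1.sin.div_const (e ^ 2))
        refine h2.congr_deriv ?_
        simp only [Pi.neg_apply]
        field_simp
        ring)
      (Continuous.intervalIntegrable (by fun_prop) _ _)
    rw [this]; simp
  have h1 : ∫ t in (0:ℝ)..(2 * π), (Real.sin t ^ 2 - e ^ 2 / 2 * Real.sin t ^ 4) ≤
      ∫ t in (0:ℝ)..(2 * π), (Real.sin (t - e * Real.sin t) * Real.sin t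
        + Real.sin t * Real.sin (e * Real.sin t) * Real.cos t) := by
    apply intervalIntegral.integral_mono_on (by positivity)
      (Continuous.intervalIntegrable (by fun_prop) _ _)
      (Continuous.intervalIntegrable (by fun_prop) _ _)
    intro t _
    rw [Real.sin_sub]
    have := Real.one_sub_sq_div_two_le_cos (x := e * Real.sin t)
    nlinarith [mul_le_mul_of_nonneg_left this (sq_nonneg (Real.sin t))]
  rw [intervalIntegral.integral_sub (Continuous.intervalIntegrable (by fun_prop) _ _)
      (Continuous.intervalIntegrable (by fun_prop) _ _),
    intervalIntegral.integral_add (Continuous.intervalIntegrable (by fun_prop) _ _)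
      (Continuous.intervalIntegrable (by fun_prop) _ _), h0,
    intervalIntegral.integral_const_mul, aux_I2, aux_I4] at h1
  have hp := Real.pi_pos
  rw [one_div (2 * π), ← div_eq_inv_mul, le_div_iff₀ (by positivity)]
  linarith

lemma aux_upper (e : ℝ) (he : 0 < e) (he1 : e < 1) :
    besselJ 1 e ≤ e / 2 * (1 - 11 * e ^ 2 / 128) := by
  unfold besselJ
  have h0 : ∫ t in (0:ℝ)..(2 * π), Real.cos (e * Real.sin t) * Real.cos t = 0 := by
    have := intervalIntegral.integral_eq_sub_of_hasDerivAt (a := 0) (b := 2 * π)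
      (f := fun t => Real.sin (e * Real.sin t) / e)
      (f' := fun t => Real.cos (e * Real.sin t) * Real.cos t)
      (fun t _ => by
        have h1 : HasDerivAt (fun t => e * Real.sin t) (e * Real.cos t) t :=
          (Real.hasDerivAt_sin t).const_mul e
        refine (h1.sin.div_const e).congr_deriv ?_
        field_simp)
      (Continuous.intervalIntegrable (by fun_prop) _ _)
    rw [this]; simp
  have h1 : ∫ t in (0:ℝ)..(2 * π), (Real.cos (((1:ℤ):ℝ) * t - e * Real.sin t)
        - Real.cos (e * Real.sin t) * Real.cos t) ≤
      ∫ t in (0:ℝ)..(2 * π), (e * Real.sin t ^ 2 - 11 * e ^ 3 / 96 * Real.sin t ^ 4) := by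
    apply intervalIntegral.integral_mono_on (by positivity)
      (Continuous.intervalIntegrable (by fun_prop) _ _)
      (Continuous.intervalIntegrable (by fun_prop) _ _)
    intro t _
    rw [Int.cast_one, one_mul, Real.cos_sub]
    have hs := Real.abs_sin_le_one t
    generalize Real.sin t = s at *
    have habs : |e * s| = e * |s| := by rw [abs_mul, abs_of_pos he]
    have hle : |e * s| ≤ 1 := by rw [habs]; nlinarith [abs_nonneg s]
    have hb : |Real.sin (e * s) - (e * s - (e * s) ^ 3 / 6)| ≤ |e * s| ^ 4 * (5 / 96) := by
      refine (Real.sin_bound hle).trans ?_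
      have h4 : 0 ≤ |e * s| ^ 4 := by positivity
      nlinarith [mul_le_mul_of_nonneg_left hle h4]
    have hm : s * (Real.sin (e * s) - (e * s - (e * s) ^ 3 / 6)) ≤
        5 / 96 * e ^ 3 * s ^ 4 := by
      calc _ ≤ |s| * |Real.sin (e * s) - (e * s - (e * s) ^ 3 / 6)| := by
            rw [← abs_mul]; exact le_abs_self _
        _ ≤ 1 * (|e * s| ^ 4 * (5 / 96)) := by gcongr
        _ = 5 / 96 * (e ^ 3 * e) * s ^ 4 := by
            rw [habs, mul_pow, Even.pow_abs (by decide)]; ring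
        _ ≤ 5 / 96 * (e ^ 3 * 1) * s ^ 4 := by gcongr
        _ = _ := by ring
    nlinarith
  rw [intervalIntegral.integral_sub (Continuous.intervalIntegrable (by fun_prop) _ _)
      (Continuous.intervalIntegrable (by fun_prop) _ _),
    intervalIntegral.integral_sub (Continuous.intervalIntegrable (by fun_prop) _ _)
      (Continuous.intervalIntegrable (by fun_prop) _ _), h0,
    intervalIntegral.integral_const_mul, intervalIntegral.integral_const_mul,
    aux_I2, aux_I4] at h1
  have hp := Real.pi_pos
  rw [one_div, ← div_eq_inv_mul, div_le_iff₀ (by positivity)]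
  linarith

/-- There is no `e ∈ (0,1)` at which `α̂` and `β̂` vanish simultaneously: the zeros of
`∂A₁/∂G` and `∂B₁/∂G` on `0 < e < 1` are distinct. -/
theorem stmt_7 (e : ℝ) (he : e ∈ Set.Ioo (0:ℝ) 1) :
    ¬ (alphaHat e = 0 ∧ betaHat e = 0) := by
  rintro ⟨ha, hb⟩
  obtain ⟨h0, h1⟩ := he
  have hl := aux_lower e h0
  have hu := aux_upper e h0 h1
  unfold alphaHat at ha
  unfold betaHat at hb
  generalize besselJ 1 e = J at *
  generalize besselJd 1 e = D at *
  obtain ⟨u, hu'⟩ : ∃ u, u = 1 - e ^ 2 := ⟨_, rfl⟩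
  have hx : e ^ 2 = 1 - u := by linarith
  rw [hx] at ha hb hl hu
  have hu0 : 0 < u := by nlinarith
  have hu1 : u < 1 := by nlinarith
  have hD : 0 < D := by linarith
  have hdet : e * D * (u - 1) * (2 * u ^ 3 + 4 * u ^ 2 + 7 * u - 4) = 0 := by
    linear_combination (3 * u) * ha + (2 * u ^ 2 + 4) * hb
  have hr : 2 * u ^ 3 + 4 * u ^ 2 + 7 * u - 4 = 0 := by
    rcases mul_eq_zero.1 hdet with h | h
    · exact absurd h (mul_ne_zero (by positivity) (by linarith))
    · exact h
  have hA : 0.43 < u := by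
    by_contra h
    push Not at h
    have h2 : u ^ 2 ≤ 0.43 ^ 2 := by gcongr
    have h3 : u ^ 3 ≤ 0.43 ^ 3 := by gcongr
    norm_num at h2 h3 h
    linarith
  have hB : u < 0.45 := by
    by_contra h
    push Not at h
    have h2 : 0.45 ^ 2 ≤ u ^ 2 := by gcongr
    have h3 : 0.45 ^ 3 ≤ u ^ 3 := by gcongr
    norm_num at h2 h3 h
    linarith
  have e1 : 3 * u * J ≤ 3 * u * (e / 2 * (1 - 11 * (1 - u) / 128)) := by gcongr
  have e2 : e * (u ^ 2 + u + 1) * (1 / 2 * (1 - 3 * (1 - u) / 8)) ≤ e * (u ^ 2 + u + 1) * D := by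
    gcongr
  have e3 : e * (3 * u * (1 - 11 * (1 - u) / 128) - (u ^ 2 + u + 1) * (1 - 3 * (1 - u) / 8)) ≥ 0 := by
    linarith
  have e4 := nonneg_of_mul_nonneg_right e3 h0
  norm_num at hA hB
  nlinarith [mul_pos (sub_pos.2 hA) (sub_pos.2 hB)]
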